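/- Let (v₁, v₂, v₃) be an orthonormal basis of ℝ³, let λ > λ₃ ≥ 0 with λ > 0, and set M := λ(v₁v₁ᵀ + v₂v₂ᵀ) + λ₃v₃v₃ᵀ. Let the set of warping directions be U := {cos(nπ/3)·v₁ + sin(nπ/3)·v₂ : n ∈ ℤ} (six unit vectors). Then for every u_q ∈ U, every θ ∈ (0, π), and every unit vector v ∈ ℝ³ that is an eigenvector of M, there exists u_p ∈ {−u_q} ∪ {u ∈ U : ⟨u, u_q⟩ = 1/2} such that tr(M(I − R_a(π,v)·R_a(θ,−u_q)·R_a(θ,u_p))) < tr(M(I − R_a(π,v))). -/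

import Mathlib

open Matrix Real

noncomputable section

/-- The hat map: u^∧ y = u × y. -/
def hat (u : Fin 3 → ℝ) : Matrix (Fin 3) (Fin 3) ℝ :=
  !![0, -u 2, u 1; u 2, 0, -u 0; -u 1, u 0, 0]

/-- The Rodrigues rotation R_a(θ, u) = I + sin θ · u^∧ + (1 − cos θ)·(u^∧)². -/
def Ra (θ : ℝ) (u : Fin 3 → ℝ) : Matrix (Fin 3) (Fin 3) ℝ :=
  1 + Real.sin θ • hat u + (1 - Real.cos θ) • (hat u * hat u)

theorem trace_mul_Ra_mul_Ra (N : Matrix (Fin 3) (Fin 3) ℝ) (hN : N.IsSymm) (θ : ℝ)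
    {a b : Fin 3 → ℝ} (ha : a ⬝ᵥ a = 1) (hb : b ⬝ᵥ b = 1) :
    (N * Ra θ a * Ra θ b).trace = N.trace
      + (1 - cos θ) * (a ⬝ᵥ N *ᵥ a + b ⬝ᵥ N *ᵥ b - 2 * N.trace)
      + sin θ ^ 2 * (a ⬝ᵥ N *ᵥ b - (a ⬝ᵥ b) * N.trace)
      + sin θ * (1 - cos θ) * ((a ⨯₃ b) ⬝ᵥ N *ᵥ a + (a ⨯₃ b) ⬝ᵥ N *ᵥ b)
      + (1 - cos θ) ^ 2 *
        ((a ⬝ᵥ b) * (a ⬝ᵥ N *ᵥ b) - a ⬝ᵥ N *ᵥ a - b ⬝ᵥ N *ᵥ b + N.trace) := by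
  suffices h : (N * Ra θ a * Ra θ b).trace = N.trace
      + (1 - cos θ) * (a ⬝ᵥ N *ᵥ a + b ⬝ᵥ N *ᵥ b - (a ⬝ᵥ a + b ⬝ᵥ b) * N.trace)
      + sin θ ^ 2 * (a ⬝ᵥ N *ᵥ b - (a ⬝ᵥ b) * N.trace)
      + sin θ * (1 - cos θ) * ((a ⨯₃ b) ⬝ᵥ N *ᵥ a + (a ⨯₃ b) ⬝ᵥ N *ᵥ b)
      + (1 - cos θ) ^ 2 * ((a ⬝ᵥ b) * (a ⬝ᵥ N *ᵥ b) - (b ⬝ᵥ b) * (a ⬝ᵥ N *ᵥ a)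
        - (a ⬝ᵥ a) * (b ⬝ᵥ N *ᵥ b) + (a ⬝ᵥ a) * (b ⬝ᵥ b) * N.trace) by
    rw [h, ha, hb]; ring
  have h10 : N 1 0 = N 0 1 := hN.apply 0 1
  have h20 : N 2 0 = N 0 2 := hN.apply 0 2
  have h21 : N 2 1 = N 1 2 := hN.apply 1 2
  simp [Ra, hat, Matrix.trace, Matrix.mul_apply, Fin.sum_univ_three, dotProduct, mulVec,
    cross_apply, h10, h20, h21]
  ring

theorem Ra_pi {v : Fin 3 → ℝ} (hv : v ⬝ᵥ v = 1) : Ra π v = (2 : ℝ) • vecMulVec v v - 1 := by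
  simp only [dotProduct, Fin.sum_univ_three] at hv
  ext i j
  fin_cases i <;> fin_cases j <;>
    simp [Ra, hat, vecMulVec_apply] <;> linarith

/-- The decrease of the potential when a critical point `Ra π v` is warped about two further
eigenvectors `a`, `b` of `M`, coplanar with `v`. -/
theorem trace_gap {M : Matrix (Fin 3) (Fin 3) ℝ} (hM : M.IsSymm) {μ lam : ℝ} (θ : ℝ)
    {v a b : Fin 3 → ℝ} (hv : v ⬝ᵥ v = 1) (ha : a ⬝ᵥ a = 1) (hb : b ⬝ᵥ b = 1)
    (hMv : M *ᵥ v = μ • v) (hMa : M *ᵥ a = lam • a) (hMb : M *ᵥ b = lam • b)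
    (hvab : a ⨯₃ b ⬝ᵥ v = 0) :
    (M * (1 - Ra π v)).trace - (M * (1 - Ra π v * Ra θ a * Ra θ b)).trace =
      (1 - cos θ) * (2 * μ * (a ⬝ᵥ v) ^ 2 + 2 * μ * (b ⬝ᵥ v) ^ 2 - 2 * lam
          - 2 * (2 * μ - M.trace))
      + sin θ ^ 2 * (2 * μ * (a ⬝ᵥ v) * (b ⬝ᵥ v) - lam * (a ⬝ᵥ b)
          - (a ⬝ᵥ b) * (2 * μ - M.trace))
      + (1 - cos θ) ^ 2 * ((a ⬝ᵥ b) * (2 * μ * (a ⬝ᵥ v) * (b ⬝ᵥ v) - lam * (a ⬝ᵥ b))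
          - 2 * μ * (a ⬝ᵥ v) ^ 2 - 2 * μ * (b ⬝ᵥ v) ^ 2 + 2 * lam + (2 * μ - M.trace)) := by
  obtain ⟨N, hN⟩ : ∃ N, N = M * Ra π v := ⟨_, rfl⟩
  have hN' : N = (2 * μ) • vecMulVec v v - M := by
    rw [hN, Ra_pi hv, mul_sub, mul_smul_comm, mul_vecMulVec, hMv, smul_vecMulVec, smul_smul,
      mul_one]
  have hsymm : N.IsSymm := by
    rw [hN']
    refine IsSymm.sub (IsSymm.smul ?_ _) hM
    exact transpose_vecMulVec v v
  have htr : N.trace = 2 * μ - M.trace := by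
    rw [hN', trace_sub, trace_smul, trace_vecMulVec, hv, smul_eq_mul, mul_one]
  have hmul : ∀ x, N *ᵥ x = (2 * μ * (x ⬝ᵥ v)) • v - M *ᵥ x := fun x => by
    rw [hN', sub_mulVec, smul_mulVec, vecMulVec_mulVec, op_smul_eq_smul, smul_smul,
      dotProduct_comm v x]
  have hca : a ⨯₃ b ⬝ᵥ a = 0 := by rw [dotProduct_comm]; exact dot_self_cross a b
  have hcb : a ⨯₃ b ⬝ᵥ b = 0 := by rw [dotProduct_comm]; exact dot_cross_self a b
  have h := trace_mul_Ra_mul_Ra N hsymm θ ha hb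
  simp only [mul_sub, trace_sub, ← mul_assoc, ← hN, mul_one]
  rw [h]
  simp only [hmul, hMa, hMb, htr, dotProduct_sub, dotProduct_smul, hvab, hca, hcb, ha, hb,
    smul_eq_mul]
  ring

theorem trace_lt_of_double_warp {M : Matrix (Fin 3) (Fin 3) ℝ} (hM : M.IsSymm) {μ lam θ : ℝ}
    {u v : Fin 3 → ℝ} (hθ : θ ∈ Set.Ioo 0 π) (hv : v ⬝ᵥ v = 1) (hu : u ⬝ᵥ u = 1)
    (hMv : M *ᵥ v = μ • v) (hMu : M *ᵥ u = lam • u)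
    (hpos : 0 < 2 * μ * (u ⬝ᵥ v) ^ 2 - lam - (2 * μ - M.trace)) :
    (M * (1 - Ra π v * Ra θ u * Ra θ u)).trace < (M * (1 - Ra π v)).trace := by
  have hgap := trace_gap hM θ hv hu hu hMv hMu hMu (by rw [cross_self, zero_dotProduct])
  rw [hu] at hgap
  have hsin : 0 < sin θ := sin_pos_of_mem_Ioo hθ
  have hprod : 0 < 2 * sin θ ^ 2 * (2 * μ * (u ⬝ᵥ v) ^ 2 - lam - (2 * μ - M.trace)) := by
    positivity
  rw [sin_sq] at hgap hprod
  linarith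

theorem trace_lt_of_sixty_degree_warp {M : Matrix (Fin 3) (Fin 3) ℝ} (hM : M.IsSymm)
    {lam l₃ θ p q k : ℝ} {u e v : Fin 3 → ℝ} (hθ : θ ∈ Set.Ioo 0 π)
    (htr : M.trace = 2 * lam + l₃) (huu : u ⬝ᵥ u = 1) (hee : e ⬝ᵥ e = 1) (hue : u ⬝ᵥ e = 0)
    (hMu : M *ᵥ u = lam • u) (hMe : M *ᵥ e = lam • e) (hv : v = p • u + q • e)
    (hpq : p ^ 2 + q ^ 2 = 1) (hk : k ^ 2 = 3 / 4)
    (hpos : 0 < lam * (1 / 2 - p ^ 2 - 2 * k * p * q) + l₃) :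
    (M * (1 - Ra π v * Ra θ (-u) * Ra θ ((1 / 2 : ℝ) • u + k • e))).trace <
      (M * (1 - Ra π v)).trace := by
  have heu : e ⬝ᵥ u = 0 := by rw [dotProduct_comm, hue]
  have hvv : v ⬝ᵥ v = 1 := by
    simp [hv, huu, hee, hue, heu]; linarith
  have hbb : ((1 / 2 : ℝ) • u + k • e) ⬝ᵥ ((1 / 2 : ℝ) • u + k • e) = 1 := by
    simp [huu, hee, hue, heu]; linarith
  have hab : -u ⬝ᵥ ((1 / 2 : ℝ) • u + k • e) = -(1 / 2) := by
    simp [huu, hue]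
  have hav : -u ⬝ᵥ v = -p := by simp [hv, huu, hue]
  have hbv : ((1 / 2 : ℝ) • u + k • e) ⬝ᵥ v = p / 2 + k * q := by
    simp [hv, huu, hee, hue, heu]; ring
  have hbv_sq : (p / 2 + k * q) ^ 2 = p ^ 2 / 4 + k * p * q + 3 / 4 * (1 - p ^ 2) := by
    linear_combination q ^ 2 * hk + 3 / 4 * hpq
  have hMv : M *ᵥ v = lam • v := by
    simp only [hv, mulVec_add, mulVec_smul, hMu, hMe, smul_add, smul_comm lam]
  have hMb : M *ᵥ ((1 / 2 : ℝ) • u + k • e) = lam • ((1 / 2 : ℝ) • u + k • e) := by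
    simp only [mulVec_add, mulVec_smul, hMu, hMe, smul_add, smul_comm lam]
  have hvab : (-u) ⨯₃ ((1 / 2 : ℝ) • u + k • e) ⬝ᵥ v = 0 := by
    rw [hv]
    simp [cross_apply, dotProduct, Fin.sum_univ_three]; ring
  have hgap := trace_gap hM θ hvv (by simpa using huu) hbb hMv
    (by rw [mulVec_neg, hMu, smul_neg]) hMb hvab
  rw [hab, hav, hbv, hbv_sq, htr, sin_sq] at hgap
  have hcos_lt : cos θ < 1 := by
    have hsin := sin_pos_of_mem_Ioo hθ
    nlinarith [sin_sq_add_cos_sq θ]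
  have hlt_cos : -1 < cos θ := by
    have hsin := sin_pos_of_mem_Ioo hθ
    nlinarith [sin_sq_add_cos_sq θ]
  have hprod : 0 < (1 - cos θ) * (1 + cos θ) *
      (lam * (1 / 2 - p ^ 2 - 2 * k * p * q) + l₃) :=
    mul_pos (mul_pos (by linarith) (by linarith)) hpos
  linarith

theorem exists_synergistic_warp {M : Matrix (Fin 3) (Fin 3) ℝ} (hM : M.IsSymm)
    {lam l₃ θ : ℝ} {u e v : Fin 3 → ℝ} (hl₃ : 0 ≤ l₃) (hlam : 0 < lam) (hθ : θ ∈ Set.Ioo 0 π)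
    (htr : M.trace = 2 * lam + l₃) (huu : u ⬝ᵥ u = 1) (hee : e ⬝ᵥ e = 1) (hue : u ⬝ᵥ e = 0)
    (hMu : M *ᵥ u = lam • u) (hMe : M *ᵥ e = lam • e)
    (hv : v ⬝ᵥ v = 1) (hvspan : ∃ p q : ℝ, v = p • u + q • e) :
    ∃ up, (up = -u ∨ ∃ k : ℝ, (k = √3 / 2 ∨ k = -(√3 / 2)) ∧ up = (1 / 2 : ℝ) • u + k • e) ∧
      (M * (1 - Ra π v * Ra θ (-u) * Ra θ up)).trace < (M * (1 - Ra π v)).trace := by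
  obtain ⟨p, q, hpqv⟩ := hvspan
  have heu : e ⬝ᵥ u = 0 := by rw [dotProduct_comm, hue]
  have hpq : p ^ 2 + q ^ 2 = 1 := by
    simp [hpqv, huu, hee, hue, heu] at hv; linarith
  have h3 : (√3 / 2) ^ 2 = (3 / 4 : ℝ) := by
    rw [div_pow, sq_sqrt (by norm_num)]; norm_num
  by_cases h₀ : 0 < lam * (2 * p ^ 2 - 1) + l₃
  · have hMv : M *ᵥ v = lam • v := by
      simp only [hpqv, mulVec_add, mulVec_smul, hMu, hMe, smul_add, smul_comm lam]
    have huv : -u ⬝ᵥ v = -p := by simp [hpqv, huu, hue]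
    refine ⟨-u, Or.inl rfl, trace_lt_of_double_warp hM hθ hv (by simpa using huu) hMv
      (by rw [mulVec_neg, hMu, smul_neg]) ?_⟩
    rw [huv, htr]
    linarith
  by_cases h₁ : 0 < lam * (1 / 2 - p ^ 2 - 2 * (√3 / 2) * p * q) + l₃
  · exact ⟨_, Or.inr ⟨_, Or.inl rfl, rfl⟩,
      trace_lt_of_sixty_degree_warp hM hθ htr huu hee hue hMu hMe hpqv hpq h3 h₁⟩
  by_cases h₂ : 0 < lam * (1 / 2 - p ^ 2 - 2 * -(√3 / 2) * p * q) + l₃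
  · exact ⟨_, Or.inr ⟨_, Or.inr rfl, rfl⟩,
      trace_lt_of_sixty_degree_warp hM hθ htr huu hee hue hMu hMe hpqv hpq
        (by rw [neg_sq, h3]) h₂⟩
  exfalso
  have hp : lam * (2 * p ^ 2 - 1) = 0 := by linarith
  have hkpq : lam * (√3 / 2 * p * q) = 0 := by linarith
  have hp' : 2 * p ^ 2 - 1 = 0 := (mul_eq_zero.mp hp).resolve_left hlam.ne'
  have hkpq' := (mul_eq_zero.mp hkpq).resolve_left hlam.ne'
  have : (√3 / 2 * p * q) ^ 2 = 3 / 16 := by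
    rw [mul_pow, mul_pow, h3, show p ^ 2 = 1 / 2 by linarith, show q ^ 2 = 1 / 2 by linarith]
    norm_num
  rw [hkpq'] at this
  norm_num at this

theorem sum_dotProduct_smul_eq {v₁ v₂ v₃ : Fin 3 → ℝ}
    (h11 : v₁ ⬝ᵥ v₁ = 1) (h22 : v₂ ⬝ᵥ v₂ = 1) (h33 : v₃ ⬝ᵥ v₃ = 1)
    (h12 : v₁ ⬝ᵥ v₂ = 0) (h13 : v₁ ⬝ᵥ v₃ = 0) (h23 : v₂ ⬝ᵥ v₃ = 0) (v : Fin 3 → ℝ) :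
    v = (v₁ ⬝ᵥ v) • v₁ + (v₂ ⬝ᵥ v) • v₂ + (v₃ ⬝ᵥ v) • v₃ := by
  have hrows : Matrix.of ![v₁, v₂, v₃] * (Matrix.of ![v₁, v₂, v₃])ᵀ = 1 := by
    ext i j
    change ![v₁, v₂, v₃] i ⬝ᵥ ![v₁, v₂, v₃] j = _
    fin_cases i <;> fin_cases j <;>
      simp [h11, h22, h33, h12, h13, h23, dotProduct_comm v₂ v₁, dotProduct_comm v₃ v₁,
        dotProduct_comm v₃ v₂]
  have hcols := mul_eq_one_comm.mp hrows
  have h := congrArg (· *ᵥ v) hcols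
  simp only [← mulVec_mulVec, one_mulVec] at h
  conv_lhs => rw [← h]
  ext i
  simp [mulVec, dotProduct, Fin.sum_univ_three]
  ring

/-- Synergy condition (Theorem 1, case 3): for M with eigenvalues
λ = λ₁ = λ₂ > λ₃ ≥ 0 and the six warping directions
cos(nπ/3)v₁ + sin(nπ/3)v₂, every warped unwanted critical point admits a
warping direction in {−u_q} ∪ {u ∈ U : ⟨u,u_q⟩ = 1/2} strictly decreasing
Ψ_M. -/
theorem synergy_case_six_directions
    (v₁ v₂ v₃ : Fin 3 → ℝ)
    (h11 : v₁ ⬝ᵥ v₁ = 1) (h22 : v₂ ⬝ᵥ v₂ = 1) (h33 : v₃ ⬝ᵥ v₃ = 1)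
    (h12 : v₁ ⬝ᵥ v₂ = 0) (h13 : v₁ ⬝ᵥ v₃ = 0) (h23 : v₂ ⬝ᵥ v₃ = 0)
    (lam l₃ : ℝ) (hl₃ : 0 ≤ l₃) (hlam : l₃ < lam) (hlampos : 0 < lam)
    (M : Matrix (Fin 3) (Fin 3) ℝ)
    (hMdef : M = lam • (vecMulVec v₁ v₁ + vecMulVec v₂ v₂) + l₃ • vecMulVec v₃ v₃)
    (U : Set (Fin 3 → ℝ))
    (hU : U = {u | ∃ n : ℤ, u = Real.cos (n * π / 3) • v₁ + Real.sin (n * π / 3) • v₂}) :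
    ∀ uq ∈ U, ∀ θ ∈ Set.Ioo (0 : ℝ) π, ∀ v : Fin 3 → ℝ, v ⬝ᵥ v = 1 →
      (∃ μ : ℝ, M *ᵥ v = μ • v) →
      ∃ up : Fin 3 → ℝ, (up = -uq ∨ (up ∈ U ∧ up ⬝ᵥ uq = 1 / 2)) ∧
        (M * (1 - Ra π v * Ra θ (-uq) * Ra θ up)).trace <
          (M * (1 - Ra π v)).trace := by
  have h21 : v₂ ⬝ᵥ v₁ = 0 := by rw [dotProduct_comm, h12]
  have h31 : v₃ ⬝ᵥ v₁ = 0 := by rw [dotProduct_comm, h13]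
  have h32 : v₃ ⬝ᵥ v₂ = 0 := by rw [dotProduct_comm, h23]
  have hmul : ∀ x, M *ᵥ x =
      lam • ((v₁ ⬝ᵥ x) • v₁ + (v₂ ⬝ᵥ x) • v₂) + l₃ • (v₃ ⬝ᵥ x) • v₃ := fun x => by
    simp only [hMdef, add_mulVec, smul_mulVec, vecMulVec_mulVec, op_smul_eq_smul]
  have hM : M.IsSymm := by
    simp only [IsSymm, hMdef, transpose_add, transpose_smul, transpose_vecMulVec]
  have htr : M.trace = 2 * lam + l₃ := by
    simp only [hMdef, trace_add, trace_smul, trace_vecMulVec, h11, h22, h33, smul_eq_mul]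
    ring
  have hMv₁ : M *ᵥ v₁ = lam • v₁ := by simp [hmul, h11, h21, h31]
  have hMv₂ : M *ᵥ v₂ = lam • v₂ := by simp [hmul, h12, h22, h32]
  rintro uq huq θ hθ v hv ⟨μ, hμ⟩
  rw [hU] at huq
  obtain ⟨n, rfl⟩ := huq
  obtain ⟨φ, hφ⟩ : ∃ φ : ℝ, φ = n * π / 3 := ⟨_, rfl⟩
  rw [← hφ]
  set u := cos φ • v₁ + sin φ • v₂ with hu
  obtain ⟨e, he⟩ : ∃ e, e = -sin φ • v₁ + cos φ • v₂ := ⟨_, rfl⟩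
  have hφ1 := sin_sq_add_cos_sq φ
  have huu : u ⬝ᵥ u = 1 := by
    simp [hu, h11, h12, h21, h22]; linarith
  have hee : e ⬝ᵥ e = 1 := by
    simp [he, h11, h12, h21, h22]; linarith
  have hue : u ⬝ᵥ e = 0 := by
    simp [hu, he, h11, h12, h21, h22]; ring
  have heu : e ⬝ᵥ u = 0 := by rw [dotProduct_comm, hue]
  have hMu : M *ᵥ u = lam • u := by
    simp only [hu, mulVec_add, mulVec_smul, hMv₁, hMv₂, smul_add, smul_comm lam]
  have hMe : M *ᵥ e = lam • e := by
    simp only [he, mulVec_add, mulVec_smul, hMv₁, hMv₂, smul_add, smul_comm lam]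
  have hexp := sum_dotProduct_smul_eq h11 h22 h33 h12 h13 h23 v
  have hd₁ : lam * (v₁ ⬝ᵥ v) = μ * (v₁ ⬝ᵥ v) := by
    simpa [hmul, h11, h12, h13] using congrArg (v₁ ⬝ᵥ ·) hμ
  have hd₂ : lam * (v₂ ⬝ᵥ v) = μ * (v₂ ⬝ᵥ v) := by
    simpa [hmul, h21, h22, h23] using congrArg (v₂ ⬝ᵥ ·) hμ
  have hd₃ : l₃ * (v₃ ⬝ᵥ v) = μ * (v₃ ⬝ᵥ v) := by
    simpa [hmul, h31, h32, h33] using congrArg (v₃ ⬝ᵥ ·) hμ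
  by_cases hμlam : μ = lam
  · have hz : v₃ ⬝ᵥ v = 0 := by
      rw [hμlam] at hd₃
      by_contra hne
      exact hlam.ne (mul_right_cancel₀ hne hd₃)
    have hvspan : ∃ p q : ℝ, v = p • u + q • e := by
      refine ⟨cos φ * (v₁ ⬝ᵥ v) + sin φ * (v₂ ⬝ᵥ v),
        -sin φ * (v₁ ⬝ᵥ v) + cos φ * (v₂ ⬝ᵥ v), ?_⟩
      conv_lhs => rw [hexp, hz]
      ext i
      simp only [hu, he, Pi.add_apply, Pi.smul_apply, smul_eq_mul]
      linear_combination (-(v₁ ⬝ᵥ v) * v₁ i - (v₂ ⬝ᵥ v) * v₂ i) * hφ1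
    obtain ⟨up, hup, hlt⟩ :=
      exists_synergistic_warp hM hl₃ hlampos hθ htr huu hee hue hMu hMe hv hvspan
    refine ⟨up, hup.imp_right ?_, hlt⟩
    rintro ⟨k, hk, rfl⟩
    refine ⟨?_, by simp [huu, heu]⟩
    rw [hU]
    rcases hk with rfl | rfl
    · refine ⟨n + 1, ?_⟩
      have hang : ((n + 1 : ℤ) : ℝ) * π / 3 = φ + π / 3 := by rw [hφ]; push_cast; ring
      rw [hang, cos_add, sin_add, cos_pi_div_three, sin_pi_div_three, hu, he]
      module
    · refine ⟨n - 1, ?_⟩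
      have hang : ((n - 1 : ℤ) : ℝ) * π / 3 = φ - π / 3 := by rw [hφ]; push_cast; ring
      rw [hang, cos_sub, sin_sub, cos_pi_div_three, sin_pi_div_three, hu, he]
      module
  · have hz₁ : v₁ ⬝ᵥ v = 0 := by
      by_contra hne
      exact hμlam (mul_right_cancel₀ hne hd₁).symm
    have hz₂ : v₂ ⬝ᵥ v = 0 := by
      by_contra hne
      exact hμlam (mul_right_cancel₀ hne hd₂).symm
    have hz₃ : v₃ ⬝ᵥ v ≠ 0 := by
      intro hz
      rw [hz₁, hz₂, hz] at hexp
      simp [hexp] at hv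
    have hμl₃ : μ = l₃ := (mul_right_cancel₀ hz₃ hd₃).symm
    have huv : -u ⬝ᵥ v = 0 := by simp [hu, hz₁, hz₂]
    refine ⟨-u, Or.inl rfl, trace_lt_of_double_warp hM hθ hv (by simpa using huu) hμ
      (by rw [mulVec_neg, hMu, smul_neg]) ?_⟩
    rw [huv, htr, hμl₃]
    linarith

end
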